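/- arXiv:1904.03667 — 2 statements merged into one kernel-verified Lean document; each statement's English description precedes it below -/
import Mathlib

section
/- There exists a constant C = C(d) > 0 such that for every integer L ≥ 1, E(X_L) ≤ C L M^{d+1} q_M^{1/d}. -/
open MeasureTheory ProbabilityTheory

/-- `γ = (y 0, …, y (ℓ-1))` is a path of `𝒫_L`: a sequence of `ℓ ≥ 1` pairwise distinct
points of the box `B(L) = [-L,L]^d` with `|γ|₁ = Σ_{i=2}^ℓ |y_i - y_{i-1}|₁ ≤ L`. -/
def pathIn (d L ℓ : ℕ) (y : ℕ → Fin d → ℤ) : Prop :=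
  1 ≤ ℓ ∧ (∀ i < ℓ, ∀ j, |y i j| ≤ (L : ℤ)) ∧
  (∀ i j, i < ℓ → j < ℓ → y i = y j → i = j) ∧
  (∑ i ∈ Finset.range (ℓ - 1), ∑ j, |y (i + 1) j - y i j|) ≤ (L : ℤ)

/-- `X_L = max_{γ ∈ 𝒫_L} Σ_{x ∈ γ} I_x`, the maximal weight of a path of `𝒫_L` in the
site-percolation given by the `{0,1}`-valued variables `I`. -/
noncomputable def XL {d : ℕ} {Ω : Type*} (I : (Fin d → ℤ) → Ω → ℕ) (L : ℕ) (ω : Ω) : ℕ :=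
  sSup {n : ℕ | ∃ ℓ y, pathIn d L ℓ y ∧ n = ∑ i ∈ Finset.range ℓ, I (y i) ω}

/-- `q_M = sup_{x ∈ ℤ^d} E(I_x)`. -/
noncomputable def qsup {d : ℕ} {Ω : Type*} [MeasurableSpace Ω] (μ : Measure Ω)
    (I : (Fin d → ℤ) → Ω → ℕ) : ℝ :=
  ⨆ x : Fin d → ℤ, ∫ ω, (I x ω : ℝ) ∂μ

/-- The family `{I_x}` is `M`-dependent: each `I_x` is independent of the σ-algebra
generated by `{I_y : |y - x|₁ > M}`. -/
def MDependent {d : ℕ} {Ω : Type*} [MeasurableSpace Ω] (μ : Measure Ω)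
    (I : (Fin d → ℤ) → Ω → ℕ) (M : ℕ) : Prop :=
  ∀ x : Fin d → ℤ,
    ProbabilityTheory.Indep (MeasurableSpace.comap (I x) inferInstance)
      (⨆ y ∈ {y : Fin d → ℤ | (M : ℤ) < ∑ j, |y j - x j|},
        MeasurableSpace.comap (I y) inferInstance) μ

/-- Total mass of the chains of length `k` for a kernel whose row sums are at most `G`. -/
lemma sum_prod_chain_le {α : Type*} [Fintype α] (K : α → α → ℝ) (hK : ∀ x y, 0 ≤ K x y)
    {G : ℝ} (hG : ∀ x, ∑ y, K x y ≤ G) (k : ℕ) :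
    ∑ f : Fin (k + 1) → α, ∏ i : Fin k, K (f i.castSucc) (f i.succ)
      ≤ Fintype.card α * G ^ k := by
  induction k with
  | zero => simp
  | succ k ih =>
    rw [← (Fin.snocEquiv (fun _ : Fin (k + 2) => α)).sum_comp, Fintype.sum_prod_type_right]
    have hG0 : ∀ f : Fin (k + 1) → α, 0 ≤ G := fun f =>
      (Finset.sum_nonneg fun y _ => hK (f 0) y).trans (hG (f 0))
    calc _ = ∑ f : Fin (k + 1) → α,
          (∏ i : Fin k, K (f i.castSucc) (f i.succ)) * ∑ y, K (f (Fin.last k)) y := by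
          refine Finset.sum_congr rfl fun f _ => ?_
          rw [Finset.mul_sum]
          refine Finset.sum_congr rfl fun y _ => ?_
          rw [Fin.prod_univ_castSucc]
          simp only [Fin.snocEquiv_apply, Fin.succ_last, Fin.snoc_last, Fin.snoc_castSucc,
            Fin.succ_castSucc]
      _ ≤ ∑ f : Fin (k + 1) → α, (∏ i : Fin k, K (f i.castSucc) (f i.succ)) * G :=
          Finset.sum_le_sum fun f _ =>
            mul_le_mul_of_nonneg_left (hG _) (Finset.prod_nonneg fun _ _ => hK _ _)
      _ ≤ _ := by
          rw [← Finset.sum_mul, pow_succ, ← mul_assoc]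
          rcases isEmpty_or_nonempty α with h | ⟨⟨a⟩⟩
          · simp
          · exact mul_le_mul_of_nonneg_right ih (hG0 fun _ => a)

lemma sum_exp_neg_mul_abs_sub_le {t : ℝ} (ht : 0 < t) (S : Finset ℤ) (x : ℤ) :
    ∑ a ∈ S, Real.exp (-t * |((a - x : ℤ) : ℝ)|) ≤ 1 + 2 / t := by
  set r := Real.exp (-t) with hr
  have hr0 : 0 < r := Real.exp_pos _
  have hr1 : r < 1 := by simpa [hr] using ht
  have hpow : ∀ n : ℕ, Real.exp (-t * n) = r ^ n := fun n => by
    rw [hr, ← Real.exp_nat_mul, mul_comm]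
  have h1 : HasSum (fun n : ℕ => Real.exp (-t * |((n : ℤ) : ℝ)|)) (1 - r)⁻¹ := by
    simpa only [Int.cast_natCast, Nat.abs_cast, hpow] using
      hasSum_geometric_of_lt_one hr0.le hr1
  have h2 : HasSum (fun n : ℕ => Real.exp (-t * |((-((n : ℤ) + 1) : ℤ) : ℝ)|))
      (r * (1 - r)⁻¹) := by
    refine ((hasSum_geometric_of_lt_one hr0.le hr1).mul_left r).congr_fun ?_
    intro n
    have : |((-((n : ℤ) + 1) : ℤ) : ℝ)| = ((n + 1 : ℕ) : ℝ) := by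
      push_cast
      rw [abs_neg, abs_of_nonneg (by positivity)]
    rw [this, hpow, pow_succ, mul_comm]
  have h3 := HasSum.of_nat_of_neg_add_one (f := fun a : ℤ => Real.exp (-t * |(a : ℝ)|)) h1 h2
  have h4 := (Equiv.subRight x).hasSum_iff.mpr h3
  refine (sum_le_hasSum S (fun _ _ => (Real.exp_pos _).le) h4).trans ?_
  have h5 : r * (1 + t) ≤ 1 := by
    have := mul_le_mul_of_nonneg_left (Real.add_one_le_exp t) hr0.le
    rw [hr, ← Real.exp_add] at this
    simpa [add_comm] using this
  have h6 : 0 < 1 - r := by linarith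
  have : (1 - r)⁻¹ + r * (1 - r)⁻¹ = (1 + r) / (1 - r) := by field_simp
  rw [this, div_le_iff₀ h6]
  have : (1 + 2 / t) * (1 - r) - (1 + r) = 2 / t * (1 - r * (1 + t)) := by field_simp; ring
  have : 0 ≤ 2 / t * (1 - r * (1 + t)) := mul_nonneg (by positivity) (by linarith)
  linarith

lemma sum_piFinset_exp_neg_mul_le {d : ℕ} {t : ℝ} (ht : 0 < t) (S : Finset ℤ) (x : Fin d → ℤ) :
    ∑ y ∈ Fintype.piFinset (fun _ : Fin d => S),
      Real.exp (-t * ((∑ j, |y j - x j| : ℤ) : ℝ)) ≤ (1 + 2 / t) ^ d := by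
  have : ∀ y : Fin d → ℤ, Real.exp (-t * ((∑ j, |y j - x j| : ℤ) : ℝ))
      = ∏ j, Real.exp (-t * |((y j - x j : ℤ) : ℝ)|) := fun y => by
    rw [← Real.exp_sum, ← Finset.mul_sum]
    push_cast
    rfl
  simp only [this]
  rw [Finset.sum_prod_piFinset S (fun j a => Real.exp (-t * |((a - x j : ℤ) : ℝ)|))]
  calc _ ≤ ∏ _j : Fin d, (1 + 2 / t) :=
        Finset.prod_le_prod (fun _ _ => Finset.sum_nonneg fun _ _ => (Real.exp_pos _).le)
          fun j _ => sum_exp_neg_mul_abs_sub_le ht S (x j)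
    _ = _ := by simp

/-- Along a well-separated set, the variables of an `M`-dependent family behave as if
independent: the probability that all of them equal `1` is at most `r ^ card`. -/
lemma integral_prod_le_pow {d M : ℕ} {Ω : Type*} [MeasurableSpace Ω] {μ : Measure Ω}
    [IsProbabilityMeasure μ] {I : (Fin d → ℤ) → Ω → ℕ} (hI : ∀ x, Measurable (I x))
    (hdep : MDependent μ I M) {r : ℝ} (hr : ∀ x, ∫ ω, (I x ω : ℝ) ∂μ ≤ r)
    (S : Finset (Fin d → ℤ))
    (hS : ∀ x ∈ S, ∀ y ∈ S, x ≠ y → (M : ℤ) < ∑ j, |y j - x j|) :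
    ∫ ω, ∏ x ∈ S, (I x ω : ℝ) ∂μ ≤ r ^ S.card := by
  induction S using Finset.induction_on with
  | empty => simp
  | insert x S hx ih =>
    have hmeas : ∀ x, Measurable fun ω => (I x ω : ℝ) :=
      fun x => measurable_from_nat.comp (hI x)
    have hind : IndepFun (fun ω => (I x ω : ℝ)) (fun ω => ∏ y ∈ S, (I y ω : ℝ)) μ := by
      rw [IndepFun_iff_Indep]
      refine indep_of_indep_of_le_right (indep_of_indep_of_le_left (hdep x) ?_) ?_
      · exact (measurable_from_nat.comp (comap_measurable (I x))).comap_le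
      · refine Measurable.comap_le ?_
        refine Finset.measurable_prod _ fun y hy => ?_
        refine measurable_from_nat.comp ((comap_measurable (I y)).mono ?_ le_rfl)
        refine le_iSup₂_of_le y ?_ le_rfl
        exact hS x (Finset.mem_insert_self _ _) y (Finset.mem_insert_of_mem hy)
          fun h => hx (h ▸ hy)
    have hmul := hind.integral_mul_eq_mul_integral (hmeas x).aestronglyMeasurable
      (Finset.measurable_prod S fun y _ => hmeas y).aestronglyMeasurable
    simp only [Finset.prod_insert hx, Finset.card_insert_of_notMem hx, pow_succ']
    have hmul' : ∫ ω, (I x ω : ℝ) * ∏ y ∈ S, (I y ω : ℝ) ∂μ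
        = (∫ ω, (I x ω : ℝ) ∂μ) * ∫ ω, ∏ y ∈ S, (I y ω : ℝ) ∂μ := hmul
    rw [hmul']
    have ih' := ih fun a ha b hb => hS a (Finset.mem_insert_of_mem ha) b
      (Finset.mem_insert_of_mem hb)
    exact mul_le_mul (hr x) ih' (integral_nonneg fun ω => Finset.prod_nonneg fun _ _ =>
      Nat.cast_nonneg _) ((integral_nonneg fun _ => Nat.cast_nonneg _).trans (hr x))

lemma sum_abs_sub_le_sum_steps {d : ℕ} (y : ℕ → Fin d → ℤ) {a b : ℕ} (hab : a ≤ b) :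
    ∑ j, |y b j - y a j| ≤ (∑ i ∈ Finset.range b, ∑ j, |y (i + 1) j - y i j|)
      - ∑ i ∈ Finset.range a, ∑ j, |y (i + 1) j - y i j| := by
  induction b, hab using Nat.le_induction with
  | base => simp
  | succ b _ ih =>
    rw [Finset.sum_range_succ]
    have : ∑ j, |y (b + 1) j - y a j|
        ≤ ∑ j, |y (b + 1) j - y b j| + ∑ j, |y b j - y a j| := by
      rw [← Finset.sum_add_distrib]
      exact Finset.sum_le_sum fun j _ => abs_sub_le _ _ _
    linarith

lemma sum_fin_succ_sub_castSucc (k : ℕ) (g : Fin (k + 1) → ℤ) :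
    ∑ i : Fin k, (g i.succ - g i.castSucc) = g (Fin.last k) - g 0 := by
  induction k with
  | zero => simp
  | succ k ih =>
    rw [Fin.sum_univ_castSucc]
    have := ih fun i => g i.castSucc
    simp only [Fin.succ_castSucc, Fin.succ_last, Fin.castSucc_zero] at this ⊢
    linarith

/-- A subsequence of a path is no longer than the path. -/
lemma pathIn.sum_subsequence_le {d L ℓ : ℕ} {y : ℕ → Fin d → ℤ} (h : pathIn d L ℓ y) {k : ℕ}
    {e : Fin (k + 1) → ℕ} (he : Monotone e) (hlt : ∀ i, e i < ℓ) :
    ∑ i : Fin k, ∑ j, |y (e i.succ) j - y (e i.castSucc) j| ≤ (L : ℤ) := by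
  set P : ℕ → ℤ := fun m => ∑ i ∈ Finset.range m, ∑ j, |y (i + 1) j - y i j|
  have hnn : ∀ i, 0 ≤ ∑ j, |y (i + 1) j - y i j| :=
    fun i => Finset.sum_nonneg fun _ _ => abs_nonneg _
  calc _ ≤ ∑ i : Fin k, (P (e i.succ) - P (e i.castSucc)) :=
        Finset.sum_le_sum fun i _ => sum_abs_sub_le_sum_steps y (he i.castSucc_lt_succ.le)
    _ = P (e (Fin.last k)) - P (e 0) := sum_fin_succ_sub_castSucc k fun i => P (e i)
    _ ≤ P (e (Fin.last k)) := sub_le_self _ (Finset.sum_nonneg fun i _ => hnn i)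
    _ ≤ P (ℓ - 1) := Finset.sum_le_sum_of_subset_of_nonneg
        (Finset.range_mono (by have := hlt (Fin.last k); omega)) fun i _ _ => hnn i
    _ ≤ L := h.2.2.2

/-- The box `[-L, L]^d`. -/
noncomputable def latticeBox (d L : ℕ) : Finset (Fin d → ℤ) :=
  Fintype.piFinset fun _ => Finset.Icc (-(L : ℤ)) L

lemma card_latticeBox (d L : ℕ) : (latticeBox d L).card = (2 * L + 1) ^ d := by
  simp only [latticeBox, Fintype.card_piFinset, Int.card_Icc, Finset.prod_const,
    Finset.card_univ, Fintype.card_fin]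
  congr 1
  omega

lemma pathIn.mem_latticeBox {d L ℓ : ℕ} {y : ℕ → Fin d → ℤ} (h : pathIn d L ℓ y) {i : ℕ}
    (hi : i < ℓ) : y i ∈ latticeBox d L := by
  simp only [latticeBox, Fintype.mem_piFinset, Finset.mem_Icc]
  exact fun j => abs_le.mp (h.2.1 i hi j)

lemma pathIn.length_le {d L ℓ : ℕ} {y : ℕ → Fin d → ℤ} (h : pathIn d L ℓ y) :
    ℓ ≤ (latticeBox d L).card := by
  rw [← Finset.card_range ℓ]
  refine Finset.card_le_card_of_injOn y (fun i hi => h.mem_latticeBox (by simpa using hi)) ?_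
  intro i hi j hj hij
  exact h.2.2.1 i j (by simpa using hi) (by simpa using hj) hij

/-- The maximum defining `XL` is attained. -/
lemma exists_pathIn_XL_eq {d : ℕ} {Ω : Type*} {I : (Fin d → ℤ) → Ω → ℕ}
    (hI1 : ∀ x ω, I x ω ≤ 1) (L : ℕ) (ω : Ω) :
    ∃ ℓ y, pathIn d L ℓ y ∧ XL I L ω = ∑ i ∈ Finset.range ℓ, I (y i) ω := by
  refine Nat.sSup_mem (s := {n : ℕ | ∃ ℓ y, pathIn d L ℓ y ∧
    n = ∑ i ∈ Finset.range ℓ, I (y i) ω}) ?_ ?_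
  · exact ⟨_, 1, fun _ => 0, ⟨le_rfl, by simp, fun i j hi hj _ => by omega, by simp⟩, rfl⟩
  · refine ⟨(latticeBox d L).card, ?_⟩
    rintro n ⟨ℓ, y, h, rfl⟩
    calc _ ≤ ∑ i ∈ Finset.range ℓ, 1 := Finset.sum_le_sum fun i _ => hI1 _ _
      _ ≤ _ := by simpa using h.length_le

/-- The residue class of a lattice point modulo `M + 1`. -/
def residue {d : ℕ} (M : ℕ) (x : Fin d → ℤ) : Fin d → ZMod (M + 1) :=
  fun j => (x j : ZMod (M + 1))

lemma lt_sum_abs_sub_of_residue_eq {d M : ℕ} {x y : Fin d → ℤ} (h : residue M x = residue M y)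
    (hne : x ≠ y) : (M : ℤ) < ∑ j, |y j - x j| := by
  obtain ⟨j, hj⟩ := Function.ne_iff.mp hne
  have hdvd : ((M + 1 : ℕ) : ℤ) ∣ y j - x j :=
    (ZMod.intCast_eq_intCast_iff_dvd_sub _ _ _).mp (congrFun h j)
  have h1 : ((M + 1 : ℕ) : ℤ) ≤ |y j - x j| :=
    Int.le_of_dvd (abs_pos.mpr (sub_ne_zero.mpr (Ne.symm hj))) ((dvd_abs _ _).mpr hdvd)
  have h2 : |y j - x j| ≤ ∑ j, |y j - x j| :=
    Finset.single_le_sum (f := fun j => |y j - x j|) (fun _ _ => abs_nonneg _) (Finset.mem_univ j)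
  push_cast at h1
  linarith

/-- The `ℓ¹`-length of a finite sequence of points of the box. -/
def chainLength {d L k : ℕ} (f : Fin (k + 1) → latticeBox d L) : ℤ :=
  ∑ i : Fin k, ∑ j, |(f i.succ).1 j - (f i.castSucc).1 j|

open Classical in
/-- The injective sequences of `k + 1` points of the box in a given residue class. -/
noncomputable def classChains {d : ℕ} (L M k : ℕ) (c : Fin d → ZMod (M + 1)) :
    Finset (Fin (k + 1) → latticeBox d L) :=
  {f | Function.Injective f ∧ ∀ i, residue M (f i).1 = c}

/-- An exponentially weighted count of the open sequences in a residue class; it dominates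
`2 ^ n` for the number `n` of open points of the class on a path. -/
noncomputable def chainWeight {d : ℕ} {Ω : Type*} (I : (Fin d → ℤ) → Ω → ℕ) (L M : ℕ) (t : ℝ)
    (c : Fin d → ZMod (M + 1)) (ω : Ω) : ℝ :=
  1 + ∑ k ∈ Finset.range (latticeBox d L).card, 2 ^ (k + 1) *
    ∑ f ∈ classChains L M k c,
      Real.exp (t * L) * Real.exp (-t * (chainLength f : ℝ)) * ∏ i, (I (f i).1 ω : ℝ)

open Classical in
lemma two_pow_card_le_chainWeight {d L M ℓ : ℕ} {Ω : Type*} (I : (Fin d → ℤ) → Ω → ℕ) {t : ℝ}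
    (ht : 0 ≤ t) (c : Fin d → ZMod (M + 1)) (ω : Ω) {y : ℕ → Fin d → ℤ} (h : pathIn d L ℓ y) :
    (2 : ℝ) ^ ((Finset.range ℓ).filter fun i => I (y i) ω = 1 ∧ residue M (y i) = c).card
      ≤ chainWeight I L M t c ω := by
  set T := (Finset.range ℓ).filter fun i => I (y i) ω = 1 ∧ residue M (y i) = c with hT
  have hterm : ∀ k (f : Fin (k + 1) → latticeBox d L),
      0 ≤ Real.exp (t * L) * Real.exp (-t * (chainLength f : ℝ)) * ∏ i, (I (f i).1 ω : ℝ) :=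
    fun k f => by positivity
  have hinner : ∀ k, 0 ≤ (2 : ℝ) ^ (k + 1) * ∑ f ∈ classChains L M k c,
      Real.exp (t * L) * Real.exp (-t * (chainLength f : ℝ)) * ∏ i, (I (f i).1 ω : ℝ) :=
    fun k => mul_nonneg (by positivity) (Finset.sum_nonneg fun f _ => hterm k f)
  unfold chainWeight
  rcases hn : T.card with _ | k
  · simpa using Finset.sum_nonneg fun k _ => hinner k
  · have hmem : ∀ i, T.orderEmbOfFin hn i ∈ T := Finset.orderEmbOfFin_mem T hn
    have hlt : ∀ i, T.orderEmbOfFin hn i < ℓ := fun i =>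
      Finset.mem_range.mp (Finset.mem_filter.mp (hmem i)).1
    have hopen : ∀ i, I (y (T.orderEmbOfFin hn i)) ω = 1 ∧
        residue M (y (T.orderEmbOfFin hn i)) = c := fun i => (Finset.mem_filter.mp (hmem i)).2
    have hk : k < (latticeBox d L).card := by
      have h1 : T.card ≤ ℓ := by simpa using Finset.card_filter_le (Finset.range ℓ) _
      have := h.length_le
      omega
    set f : Fin (k + 1) → latticeBox d L :=
      fun i => ⟨y (T.orderEmbOfFin hn i), h.mem_latticeBox (hlt i)⟩ with hf
    have hfmem : f ∈ classChains L M k c := by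
      simp only [classChains, Finset.mem_filter, Finset.mem_univ, true_and]
      refine ⟨fun i j hij => ?_, fun i => (hopen i).2⟩
      exact (T.orderEmbOfFin hn).injective
        (h.2.2.1 _ _ (hlt i) (hlt j) (congrArg Subtype.val hij))
    have hlen : (chainLength f : ℝ) ≤ L := by
      exact_mod_cast h.sum_subsequence_le (T.orderEmbOfFin hn).monotone hlt
    have hone : 1 ≤ Real.exp (t * L) * Real.exp (-t * (chainLength f : ℝ)) *
        ∏ i, (I (f i).1 ω : ℝ) := by
      have : ∏ i, (I (f i).1 ω : ℝ) = 1 :=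
        Finset.prod_eq_one fun i _ => by rw [hf]; simp [(hopen i).1]
      rw [this, mul_one, ← Real.exp_add]
      refine Real.one_le_exp ?_
      nlinarith
    calc (2 : ℝ) ^ (k + 1) = 2 ^ (k + 1) * 1 := (mul_one _).symm
      _ ≤ 2 ^ (k + 1) * ∑ f ∈ classChains L M k c,
          Real.exp (t * L) * Real.exp (-t * (chainLength f : ℝ)) * ∏ i, (I (f i).1 ω : ℝ) :=
          mul_le_mul_of_nonneg_left
            (hone.trans (Finset.single_le_sum (fun f _ => hterm k f) hfmem)) (by positivity)
      _ ≤ ∑ k ∈ Finset.range (latticeBox d L).card, 2 ^ (k + 1) * ∑ f ∈ classChains L M k c,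
          Real.exp (t * L) * Real.exp (-t * (chainLength f : ℝ)) * ∏ i, (I (f i).1 ω : ℝ) :=
          Finset.single_le_sum (f := fun k => (2 : ℝ) ^ (k + 1) * ∑ f ∈ classChains L M k c,
            Real.exp (t * L) * Real.exp (-t * (chainLength f : ℝ)) * ∏ i, (I (f i).1 ω : ℝ))
            (fun k _ => hinner k) (Finset.mem_range.mpr hk)
      _ ≤ _ := by linarith

lemma integrable_prod_of_le_one {α ι Ω : Type*} [MeasurableSpace Ω] {μ : Measure Ω}
    [IsFiniteMeasure μ] [Fintype ι] {I : α → Ω → ℕ} (hI : ∀ x, Measurable (I x))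
    (hI1 : ∀ x ω, I x ω ≤ 1) (f : ι → α) :
    Integrable (fun ω => ∏ i, (I (f i) ω : ℝ)) μ := by
  refine Integrable.of_bound (C := 1) (Finset.measurable_prod _ fun i _ =>
    measurable_from_nat.comp (hI (f i))).aestronglyMeasurable (.of_forall fun ω => ?_)
  rw [Real.norm_of_nonneg (Finset.prod_nonneg fun _ _ => Nat.cast_nonneg _)]
  exact Finset.prod_le_one (fun _ _ => Nat.cast_nonneg _) fun i _ => by exact_mod_cast hI1 _ _

lemma integrable_chainWeight {d : ℕ} {Ω : Type*} [MeasurableSpace Ω] {μ : Measure Ω}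
    [IsProbabilityMeasure μ] {I : (Fin d → ℤ) → Ω → ℕ} (hI : ∀ x, Measurable (I x))
    (hI1 : ∀ x ω, I x ω ≤ 1) (L M : ℕ) (t : ℝ) (c : Fin d → ZMod (M + 1)) :
    Integrable (chainWeight I L M t c) μ :=
  (integrable_const 1).add <| integrable_finsetSum _ fun _ _ =>
    (integrable_finsetSum _ fun f _ =>
      (integrable_prod_of_le_one hI hI1 fun i => (f i).1).const_mul _).const_mul _

lemma sum_exp_chainLength_le (d L k : ℕ) {t : ℝ} (ht : 0 < t) :
    ∑ f : Fin (k + 1) → latticeBox d L, Real.exp (-t * (chainLength f : ℝ))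
      ≤ (latticeBox d L).card * ((1 + 2 / t) ^ d) ^ k := by
  have := sum_prod_chain_le (α := latticeBox d L)
    (fun x y => Real.exp (-t * ((∑ j, |y.1 j - x.1 j| : ℤ) : ℝ)))
    (fun _ _ => (Real.exp_pos _).le) (G := (1 + 2 / t) ^ d) (fun x => by
      rw [Finset.sum_coe_sort (latticeBox d L)
        fun y => Real.exp (-t * ((∑ j, |y j - x.1 j| : ℤ) : ℝ))]
      exact sum_piFinset_exp_neg_mul_le ht _ _) k
  rw [Fintype.card_coe] at this
  refine le_of_eq_of_le (Finset.sum_congr rfl fun f _ => ?_) this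
  rw [← Real.exp_sum, ← Finset.mul_sum, chainLength]
  push_cast
  rfl

lemma integral_prod_classChains_le {d L M k : ℕ} {Ω : Type*} [MeasurableSpace Ω] {μ : Measure Ω}
    [IsProbabilityMeasure μ] {I : (Fin d → ℤ) → Ω → ℕ} (hI : ∀ x, Measurable (I x))
    (hdep : MDependent μ I M) {r : ℝ} (hr : ∀ x, ∫ ω, (I x ω : ℝ) ∂μ ≤ r)
    {c : Fin d → ZMod (M + 1)} {f : Fin (k + 1) → latticeBox d L}
    (hf : f ∈ classChains L M k c) :
    ∫ ω, ∏ i, (I (f i).1 ω : ℝ) ∂μ ≤ r ^ (k + 1) := by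
  classical
  simp only [classChains, Finset.mem_filter, Finset.mem_univ, true_and] at hf
  have hinj : Function.Injective fun i => (f i).1 := Subtype.val_injective.comp hf.1
  have h := integral_prod_le_pow hI hdep hr (Finset.univ.image fun i => (f i).1) (by
    simp only [Finset.mem_image, Finset.mem_univ, true_and]
    rintro _ ⟨i, rfl⟩ _ ⟨j, rfl⟩ hne
    exact lt_sum_abs_sub_of_residue_eq ((hf.2 i).trans (hf.2 j).symm) hne)
  rw [Finset.card_image_of_injective _ hinj, Finset.card_univ, Fintype.card_fin] at h
  simpa only [Finset.prod_image hinj.injOn] using h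

lemma integral_chainWeight_le {d L M : ℕ} (hd : 2 ≤ d) (hL : 1 ≤ L) {Ω : Type*}
    [MeasurableSpace Ω] {μ : Measure Ω} [IsProbabilityMeasure μ] {I : (Fin d → ℤ) → Ω → ℕ}
    (hI : ∀ x, Measurable (I x)) (hI1 : ∀ x ω, I x ω ≤ 1) (hdep : MDependent μ I M) {s : ℝ}
    (hs : 0 < s) (hs4 : s ≤ 1 / 4) (hr : ∀ x, ∫ ω, (I x ω : ℝ) ∂μ ≤ s ^ d)
    (c : Fin d → ZMod (M + 1)) :
    ∫ ω, chainWeight I L M (8 * s) c ω ∂μ ≤ Real.exp ((8 + 6 * d) * (L * s)) := by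
  have hint : ∀ k, ∀ f ∈ classChains L M k c, Integrable (fun ω =>
      Real.exp (8 * s * L) * Real.exp (-(8 * s) * (chainLength f : ℝ)) *
        ∏ i, (I (f i).1 ω : ℝ)) μ :=
    fun k f _ => (integrable_prod_of_le_one hI hI1 fun i => (f i).1).const_mul _
  have hG : s ^ d * (1 + 2 / (8 * s)) ^ d ≤ 1 / 4 := by
    rw [← mul_pow]
    have h1 : s * (1 + 2 / (8 * s)) = s + 1 / 4 := by field_simp; ring
    calc (s * (1 + 2 / (8 * s))) ^ d ≤ (1 / 2) ^ d :=
          pow_le_pow_left₀ (by positivity) (by rw [h1]; linarith) d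
      _ ≤ (1 / 2) ^ 2 := pow_le_pow_of_le_one (by norm_num) (by norm_num) hd
      _ = 1 / 4 := by norm_num
  set B : ℝ := ((latticeBox d L).card : ℝ) with hB
  set E := Real.exp (8 * s * L)
  have hlevel : ∀ k, 2 ^ (k + 1) * ∫ ω, ∑ f ∈ classChains L M k c,
      E * Real.exp (-(8 * s) * (chainLength f : ℝ)) * ∏ i, (I (f i).1 ω : ℝ) ∂μ
      ≤ 2 * (E * B * s ^ d) * (1 / 2) ^ k := fun k => by
    rw [integral_finsetSum _ (hint k)]
    have h1 : ∑ f ∈ classChains L M k c, ∫ ω, E * Real.exp (-(8 * s) * (chainLength f : ℝ)) *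
        ∏ i, (I (f i).1 ω : ℝ) ∂μ
        ≤ E * (s ^ d) ^ (k + 1) * (B * ((1 + 2 / (8 * s)) ^ d) ^ k) := by
      calc _ ≤ ∑ f ∈ classChains L M k c,
            E * (s ^ d) ^ (k + 1) * Real.exp (-(8 * s) * (chainLength f : ℝ)) := by
            refine Finset.sum_le_sum fun f hf => ?_
            rw [integral_const_mul, mul_right_comm]
            refine mul_le_mul_of_nonneg_right ?_ (Real.exp_pos _).le
            exact mul_le_mul_of_nonneg_left (integral_prod_classChains_le hI hdep hr hf)
              (Real.exp_pos _).le
        _ ≤ ∑ f : Fin (k + 1) → latticeBox d L,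
            E * (s ^ d) ^ (k + 1) * Real.exp (-(8 * s) * (chainLength f : ℝ)) :=
            Finset.sum_le_sum_of_subset_of_nonneg (Finset.subset_univ _)
              fun _ _ _ => by positivity
        _ ≤ _ := by
            rw [← Finset.mul_sum]
            exact mul_le_mul_of_nonneg_left (sum_exp_chainLength_le d L k (by positivity))
              (by positivity)
    calc _ ≤ 2 ^ (k + 1) * (E * (s ^ d) ^ (k + 1) * (B * ((1 + 2 / (8 * s)) ^ d) ^ k)) :=
          mul_le_mul_of_nonneg_left h1 (by positivity)
      _ = 2 * (E * B * s ^ d) * (2 * (s ^ d * (1 + 2 / (8 * s)) ^ d)) ^ k := by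
          rw [mul_pow, mul_pow]; ring
      _ ≤ _ := by
          refine mul_le_mul_of_nonneg_left (pow_le_pow_left₀ (by positivity) ?_ k)
            (by positivity)
          linarith
  have hgeom : ∀ n : ℕ, ∑ k ∈ Finset.range n, (1 / 2 : ℝ) ^ k ≤ 2 := fun n =>
    (sum_le_hasSum _ (fun _ _ => by positivity) hasSum_geometric_two)
  have hmain : ∫ ω, chainWeight I L M (8 * s) c ω ∂μ ≤ 1 + 4 * (E * B * s ^ d) := by
    unfold chainWeight
    rw [integral_add (integrable_const _) (integrable_finsetSum _ fun k _ =>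
      (integrable_finsetSum _ (hint k)).const_mul _), integral_finsetSum _ fun k _ =>
      (integrable_finsetSum _ (hint k)).const_mul _]
    simp only [integral_const_mul, integral_const, probReal_univ, smul_eq_mul, mul_one]
    have := Finset.sum_le_sum fun k (_ : k ∈ Finset.range (latticeBox d L).card) => hlevel k
    rw [← Finset.mul_sum] at this
    have h2 := mul_le_mul_of_nonneg_left (hgeom (latticeBox d L).card)
      (show 0 ≤ 2 * (E * B * s ^ d) by positivity)
    linarith
  have hLr : (1 : ℝ) ≤ L := by exact_mod_cast hL
  have hBs : B * s ^ d ≤ (3 * (L * s)) ^ d := by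
    rw [hB, card_latticeBox]
    push_cast
    rw [← mul_pow]
    exact pow_le_pow_left₀ (by positivity) (by nlinarith) d
  have hpoly : 1 + 4 * (3 * (L * s)) ^ d ≤ Real.exp (6 * d * (L * s)) := by
    have h4 : (4 : ℝ) ≤ 2 ^ d := by
      calc (4 : ℝ) = 2 ^ 2 := by norm_num
        _ ≤ 2 ^ d := pow_le_pow_right₀ (by norm_num) hd
    have hadd : (1 : ℝ) ^ d + (6 * (L * s)) ^ d ≤ (1 + 6 * (L * s)) ^ d :=
      pow_add_pow_le (by norm_num) (by positivity) (by omega)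
    calc 1 + 4 * (3 * (L * s)) ^ d ≤ 1 + 2 ^ d * (3 * (L * s)) ^ d := by gcongr
      _ = 1 ^ d + (6 * (L * s)) ^ d := by rw [← mul_pow, one_pow]; ring_nf
      _ ≤ (1 + 6 * (L * s)) ^ d := hadd
      _ ≤ Real.exp (6 * (L * s)) ^ d := pow_le_pow_left₀ (by positivity)
          (by linarith [Real.add_one_le_exp (6 * (L * s))]) d
      _ = _ := by rw [← Real.exp_nat_mul]; ring_nf
  have hE1 : 1 ≤ E := Real.one_le_exp (by positivity)
  calc _ ≤ 1 + 4 * (E * B * s ^ d) := hmain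
    _ ≤ E * (1 + 4 * (3 * (L * s)) ^ d) := by nlinarith
    _ ≤ E * Real.exp (6 * d * (L * s)) := by gcongr
    _ = _ := by rw [← Real.exp_add]; ring_nf

lemma XL_mul_log_two_le {d : ℕ} {Ω : Type*} {I : (Fin d → ℤ) → Ω → ℕ}
    (hI1 : ∀ x ω, I x ω ≤ 1) (L M : ℕ) {t : ℝ} (ht : 0 ≤ t) (b : ℝ) (ω : Ω) :
    (XL I L ω : ℝ) * Real.log 2 ≤
      ∑ c : Fin d → ZMod (M + 1), (chainWeight I L M t c ω * Real.exp (-b) - 1 + b) := by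
  classical
  obtain ⟨ℓ, y, h, hX⟩ := exists_pathIn_XL_eq hI1 L ω
  have hcount : XL I L ω = ∑ c : Fin d → ZMod (M + 1),
      ((Finset.range ℓ).filter fun i => I (y i) ω = 1 ∧ residue M (y i) = c).card := by
    have h1 : XL I L ω = ((Finset.range ℓ).filter fun i => I (y i) ω = 1).card := by
      rw [hX, Finset.card_filter]
      refine Finset.sum_congr rfl fun i _ => ?_
      have := hI1 (y i) ω
      split_ifs <;> omega
    rw [h1, Finset.card_eq_sum_card_fiberwise (f := fun i => residue M (y i))
      (t := Finset.univ) (fun _ _ => by simp)]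
    simp only [Finset.filter_filter]
  rw [hcount]
  push_cast
  rw [Finset.sum_mul]
  refine Finset.sum_le_sum fun c _ => ?_
  have h1 := two_pow_card_le_chainWeight I ht c ω h
  set n := ((Finset.range ℓ).filter fun i => I (y i) ω = 1 ∧ residue M (y i) = c).card
  have h2 := Real.add_one_le_exp (n * Real.log 2 - b)
  have h3 : Real.exp (n * Real.log 2 - b) = 2 ^ n * Real.exp (-b) := by
    rw [sub_eq_add_neg, Real.exp_add, Real.exp_nat_mul, Real.exp_log two_pos]
  have h4 := mul_le_mul_of_nonneg_right h1 (Real.exp_pos (-b)).le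
  linarith

lemma integral_XL_le {d L M : ℕ} (hd : 2 ≤ d) (hL : 1 ≤ L) {Ω : Type*}
    [MeasurableSpace Ω] {μ : Measure Ω} [IsProbabilityMeasure μ] {I : (Fin d → ℤ) → Ω → ℕ}
    (hI : ∀ x, Measurable (I x)) (hI1 : ∀ x ω, I x ω ≤ 1) (hdep : MDependent μ I M) {s : ℝ}
    (hs : 0 < s) (hs4 : s ≤ 1 / 4) (hr : ∀ x, ∫ ω, (I x ω : ℝ) ∂μ ≤ s ^ d) :
    ∫ ω, (XL I L ω : ℝ) ∂μ ≤ (M + 1) ^ d * ((8 + 6 * d) * (L * s)) / Real.log 2 := by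
  have hlog : 0 < Real.log 2 := Real.log_pos one_lt_two
  set b : ℝ := (8 + 6 * d) * (L * s) with hb
  rw [le_div_iff₀ hlog, ← integral_mul_const]
  have hint : ∀ c : Fin d → ZMod (M + 1), Integrable (fun ω =>
      chainWeight I L M (8 * s) c ω * Real.exp (-b) - 1 + b) μ := fun c =>
    (((integrable_chainWeight hI hI1 L M _ c).mul_const _).sub (integrable_const _)).add
      (integrable_const _)
  calc _ ≤ ∫ ω, ∑ c : Fin d → ZMod (M + 1),
        (chainWeight I L M (8 * s) c ω * Real.exp (-b) - 1 + b) ∂μ := by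
        refine integral_mono_of_nonneg (.of_forall fun ω => ?_)
          (integrable_finsetSum _ fun c _ => hint c)
          (.of_forall fun ω => XL_mul_log_two_le hI1 L M (by positivity) b ω)
        exact mul_nonneg (Nat.cast_nonneg _) hlog.le
    _ = ∑ c : Fin d → ZMod (M + 1),
        ∫ ω, (chainWeight I L M (8 * s) c ω * Real.exp (-b) - 1 + b) ∂μ :=
        integral_finsetSum _ fun c _ => hint c
    _ ≤ ∑ _c : Fin d → ZMod (M + 1), b := by
        refine Finset.sum_le_sum fun c _ => ?_
        have hc := (integrable_chainWeight (μ := μ) hI hI1 L M (8 * s) c).mul_const (Real.exp (-b))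
        have hc' : Integrable
            (fun ω => chainWeight I L M (8 * s) c ω * Real.exp (-b) - 1) μ :=
          hc.sub (integrable_const _)
        rw [integral_add hc' (integrable_const _),
          integral_sub hc (integrable_const _), integral_mul_const]
        simp only [integral_const, probReal_univ, smul_eq_mul, one_mul]
        have h1 := mul_le_mul_of_nonneg_right
          (integral_chainWeight_le hd hL hI hI1 hdep hs hs4 hr c) (Real.exp_pos (-b)).le
        rw [← Real.exp_add, ← hb, add_neg_cancel, Real.exp_zero] at h1
        linarith
    _ = _ := by simp [ZMod.card]

/-- Expectation bound for the maximal weight of paths in `M`-dependent site-percolation: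
there is `C = C(d) > 0` such that if `{I_x}` is `M`-dependent with
`q_M = sup_x E(I_x) ≤ (3M+1)^{-d}`, then `E(X_L) ≤ C L M^{d+1} q_M^{1/d}` for all `L ≥ 1`. -/
theorem mdep_perc_weight_expectation (d : ℕ) (hd : 2 ≤ d) :
    ∃ C : ℝ, 0 < C ∧
      ∀ (M : ℕ), 1 ≤ M →
      ∀ (Ω : Type) [MeasurableSpace Ω] (μ : Measure Ω), IsProbabilityMeasure μ →
      ∀ (I : (Fin d → ℤ) → Ω → ℕ),
      (∀ x, Measurable (I x)) → (∀ x ω, I x ω ≤ 1) →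
      MDependent μ I M →
      qsup μ I ≤ 1 / ((3 * M + 1 : ℝ) ^ d) →
      ∀ L : ℕ, 1 ≤ L →
        (∫ ω, (XL I L ω : ℝ) ∂μ) ≤
          C * L * (M : ℝ) ^ (d + 1) * qsup μ I ^ ((1 : ℝ) / d) := by
  have hlog : 0 < Real.log 2 := Real.log_pos one_lt_two
  refine ⟨2 ^ d * (8 + 6 * d) / Real.log 2, by positivity, ?_⟩
  intro M hM Ω _ μ hμ I hI hI1 hdep hq L hL
  set q := qsup μ I with hqdef
  have hMr : (1 : ℝ) ≤ M := by exact_mod_cast hM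
  have hd0 : (d : ℝ) ≠ 0 := by positivity
  have hbdd : BddAbove (Set.range fun x : Fin d → ℤ => ∫ ω, (I x ω : ℝ) ∂μ) := by
    refine ⟨1, ?_⟩
    rintro _ ⟨x, rfl⟩
    calc ∫ ω, (I x ω : ℝ) ∂μ ≤ ∫ _, (1 : ℝ) ∂μ :=
          integral_mono_of_nonneg (.of_forall fun _ => Nat.cast_nonneg _) (integrable_const _)
            (.of_forall fun ω => by simpa using hI1 x ω)
      _ = 1 := by simp
  have hle : ∀ x, ∫ ω, (I x ω : ℝ) ∂μ ≤ q := fun x => le_ciSup hbdd x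
  have hq0 : 0 ≤ q := (integral_nonneg fun _ => Nat.cast_nonneg _).trans (hle 0)
  set s := q ^ ((1 : ℝ) / d) with hs
  have hs0 : 0 ≤ s := Real.rpow_nonneg hq0 _
  have hsd : s ^ d = q := by
    rw [hs, one_div, Real.rpow_inv_natCast_pow hq0 (by omega)]
  have hs4 : s ≤ 1 / 4 := by
    refine le_of_pow_le_pow_left₀ (n := d) (by omega) (by norm_num) ?_
    rw [hsd]
    refine hq.trans ?_
    rw [div_pow, one_pow]
    gcongr
    linarith
  set D : ℝ := (M + 1) ^ d * ((8 + 6 * d) * L) / Real.log 2 with hD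
  have hlim : ∫ ω, (XL I L ω : ℝ) ∂μ ≤ D * s := by
    have key : ∀ u : ℝ, 0 < u → s ≤ u → u ≤ 1 / 4 → ∫ ω, (XL I L ω : ℝ) ∂μ ≤ D * u := by
      intro u hu hsu hu4
      refine (integral_XL_le hd hL hI hI1 hdep hu hu4 fun x => (hle x).trans ?_).trans_eq ?_
      · rw [← hsd]
        exact pow_le_pow_left₀ hs0 hsu d
      · rw [hD]
        ring
    rcases hs0.eq_or_lt with h0 | hpos
    · have htend : Filter.Tendsto (fun u : ℝ => D * u) (nhdsWithin 0 (Set.Ioi 0))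
          (nhds (D * 0)) :=
        ((continuous_const.mul continuous_id).tendsto 0).mono_left nhdsWithin_le_nhds
      rw [← h0]
      refine ge_of_tendsto htend ?_
      filter_upwards [Ioc_mem_nhdsGT (show (0 : ℝ) < 1 / 4 by norm_num)] with u hu
      exact key u hu.1 (h0 ▸ hu.1.le) hu.2
    · exact key s hpos le_rfl hs4
  refine hlim.trans ?_
  have hMd : ((M : ℝ) + 1) ^ d ≤ 2 ^ d * (M : ℝ) ^ (d + 1) := by
    calc ((M : ℝ) + 1) ^ d ≤ (2 * M) ^ d := pow_le_pow_left₀ (by positivity) (by linarith) d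
      _ = 2 ^ d * (M : ℝ) ^ d := mul_pow _ _ _
      _ ≤ _ := by
        gcongr
        exact d.le_succ
  calc D * s = (M + 1 : ℝ) ^ d * ((8 + 6 * d) * L / Real.log 2 * s) := by rw [hD]; ring
    _ ≤ 2 ^ d * (M : ℝ) ^ (d + 1) * ((8 + 6 * d) * L / Real.log 2 * s) := by gcongr
    _ = _ := by ring
end

section
/- There exists a constant C = C(d) > 0 such that for every integer L ≥ 1 and every real n ≥ C M^d max{ 1, M L q_M^{1/d} }, one has P( X_L ≥ n ) ≤ 2^d exp( − n / (16 M)^d ). -/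
open MeasureTheory ProbabilityTheory

/-- Events at pairwise `M`-separated sites multiply. -/
lemma MDependent.measureReal_forall_eq_one_le {d : ℕ} {Ω : Type*} [MeasurableSpace Ω]
    {μ : Measure Ω} [IsProbabilityMeasure μ] {I : (Fin d → ℤ) → Ω → ℕ} {M : ℕ}
    (hI : MDependent μ I M) {q : ℝ} (hq : ∀ x, μ.real {ω | I x ω = 1} ≤ q)
    (S : Finset (Fin d → ℤ))
    (hS : ∀ x ∈ S, ∀ y ∈ S, x ≠ y → (M : ℤ) < ∑ j, |y j - x j|) :
    μ.real {ω | ∀ x ∈ S, I x ω = 1} ≤ q ^ S.card := by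
  classical
  induction S using Finset.induction_on with
  | empty => simp
  | insert x S hx ih =>
    have hset : {ω | ∀ y ∈ insert x S, I y ω = 1} =
        {ω | I x ω = 1} ∩ {ω | ∀ y ∈ S, I y ω = 1} := by
      ext ω; simp
    have hmul : μ ({ω | I x ω = 1} ∩ {ω | ∀ y ∈ S, I y ω = 1}) =
        μ {ω | I x ω = 1} * μ {ω | ∀ y ∈ S, I y ω = 1} := by
      refine (Indep_iff _ _ μ).1 (hI x) _ _ ⟨{1}, measurableSet_singleton _, rfl⟩ ?_
      have : {ω | ∀ y ∈ S, I y ω = 1} = ⋂ y ∈ S, I y ⁻¹' {1} := by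
        ext ω; simp
      rw [this]
      refine Finset.measurableSet_biInter S fun y hy => ?_
      have hle : MeasurableSpace.comap (I y) inferInstance ≤
          ⨆ y ∈ {y : Fin d → ℤ | (M : ℤ) < ∑ j, |y j - x j|},
            MeasurableSpace.comap (I y) inferInstance :=
        le_iSup₂_of_le y (hS x (by simp) y (by simp [hy]) (by rintro rfl; exact hx hy)) le_rfl
      exact hle _ ⟨{1}, measurableSet_singleton _, rfl⟩
    rw [hset, measureReal_def, hmul, ENNReal.toReal_mul, Finset.card_insert_of_notMem hx, pow_succ']
    exact mul_le_mul (hq x)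
      (ih fun a ha b hb => hS a (Finset.mem_insert_of_mem ha) b (Finset.mem_insert_of_mem hb))
      ENNReal.toReal_nonneg (measureReal_nonneg.trans (hq x))

lemma measureReal_eq_one_le_qsup {d : ℕ} {Ω : Type*} [MeasurableSpace Ω]
    {μ : Measure Ω} [IsProbabilityMeasure μ] {I : (Fin d → ℤ) → Ω → ℕ}
    (hm : ∀ x, Measurable (I x)) (h1 : ∀ x ω, I x ω ≤ 1) (x : Fin d → ℤ) :
    μ.real {ω | I x ω = 1} ≤ qsup μ I := by
  have hint : ∀ x, ∫ ω, (I x ω : ℝ) ∂μ = μ.real {ω | I x ω = 1} := by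
    intro x
    have hfun : (fun ω => (I x ω : ℝ)) = Set.indicator {ω | I x ω = 1} 1 := by
      ext ω
      have := h1 x ω
      by_cases h : I x ω = 1
      · simp [h]
      · simp [show I x ω = 0 by omega]
    rw [hfun]
    exact integral_indicator_one (hm x (measurableSet_singleton 1))
  rw [← hint]
  exact le_ciSup (f := fun x => ∫ ω, (I x ω : ℝ) ∂μ)
    ⟨1, by rintro _ ⟨y, rfl⟩; simpa only [hint] using measureReal_le_one⟩ x

lemma card_closedBall_l1_le {d : ℕ} (M : ℕ) (x : Fin d → ℤ) (S : Finset (Fin d → ℤ))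
    (hS : ∀ y ∈ S, ∑ j, |y j - x j| ≤ (M : ℤ)) : S.card ≤ (2 * M + 1) ^ d := by
  have hsub : S ⊆ Fintype.piFinset fun j => Finset.Icc (x j - M) (x j + M) := by
    intro y hy
    simp only [Fintype.mem_piFinset, Finset.mem_Icc]
    intro j
    have := abs_le.1 ((Finset.single_le_sum (f := fun j => |y j - x j|)
      (fun _ _ => abs_nonneg _) (Finset.mem_univ j)).trans (hS y hy))
    constructor <;> linarith [this.1, this.2]
  refine (Finset.card_le_card hsub).trans ?_
  rw [Fintype.card_piFinset]
  have : ∀ j, (Finset.Icc (x j - M) (x j + M)).card = 2 * M + 1 := fun j => by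
    rw [Int.card_Icc]; omega
  simp [this]

/-- Greedy extraction of an `M`-separated subfamily. -/
lemma exists_separated_subset {d : ℕ} (M : ℕ) (y : ℕ → Fin d → ℤ) (T : Finset ℕ)
    (hy : Set.InjOn y T) :
    ∃ U ⊆ T, (∀ i ∈ U, ∀ j ∈ U, i ≠ j → (M : ℤ) < ∑ k, |y j k - y i k|) ∧
      T.card ≤ (2 * M + 1) ^ d * U.card := by
  classical
  induction T using Finset.strongInduction with
  | H T ih =>
    rcases T.eq_empty_or_nonempty with rfl | ⟨i, hi⟩
    · exact ⟨∅, by simp⟩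
    let near := T.filter fun j => ∑ k, |y j k - y i k| ≤ (M : ℤ)
    let far := T.filter fun j => ¬ ∑ k, |y j k - y i k| ≤ (M : ℤ)
    have hfar : far ⊂ T := by
      refine Finset.filter_ssubset.2 ⟨i, hi, ?_⟩
      simp
    obtain ⟨U, hU, hsep, hcard⟩ := ih far hfar (hy.mono (by exact_mod_cast hfar.1))
    have hfarU : ∀ j ∈ U, (M : ℤ) < ∑ k, |y j k - y i k| := fun j hj =>
      not_le.1 (Finset.mem_filter.1 (hU hj)).2
    have hiU : i ∉ U := fun h => by
      have := hfarU i h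
      simp at this
      omega
    refine ⟨insert i U, Finset.insert_subset hi (hU.trans hfar.1), ?_, ?_⟩
    · intro a ha b hb hab
      rcases Finset.mem_insert.1 ha with rfl | haU <;> rcases Finset.mem_insert.1 hb with rfl | hbU
      · exact absurd rfl hab
      · exact hfarU b hbU
      · simpa only [abs_sub_comm] using hfarU a haU
      · exact hsep a haU b hbU hab
    · have hnear : near.card ≤ (2 * M + 1) ^ d := by
        rw [← Finset.card_image_of_injOn (hy.mono (Finset.coe_subset.2 (Finset.filter_subset _ T)))]
        refine card_closedBall_l1_le M (y i) _ fun z hz => ?_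
        obtain ⟨j, hj, rfl⟩ := Finset.mem_image.1 hz
        exact (Finset.mem_filter.1 hj).2
      have hsplit : near.card + far.card = T.card := Finset.card_filter_add_card_filter_not _
      rw [Finset.card_insert_of_notMem hiU]
      linarith

/-- Skipping vertices does not increase the `ℓ¹`-length of a path. -/
lemma sum_l1_subpath_le {d ℓ k : ℕ} (y : ℕ → Fin d → ℤ) (e : Fin (k + 1) → ℕ)
    (he : Monotone e) (hlt : ∀ i, e i < ℓ) :
    ∑ i : Fin k, ∑ j, |y (e i.succ) j - y (e i.castSucc) j| ≤
      ∑ i ∈ Finset.range (ℓ - 1), ∑ j, |y (i + 1) j - y i j| := by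
  let S : ℕ → ℤ := fun a => ∑ i ∈ Finset.range a, ∑ j, |y (i + 1) j - y i j|
  have hS : Monotone S := monotone_nat_of_le_succ fun a => by
    simp only [S, Finset.sum_range_succ]
    linarith [Finset.sum_nonneg fun j (_ : j ∈ Finset.univ) => abs_nonneg (y (a + 1) j - y a j)]
  have hstep : ∀ a b, a ≤ b → ∑ j, |y b j - y a j| ≤ S b - S a := by
    intro a b hab
    induction b, hab using Nat.le_induction with
    | base => simp
    | succ b _ ih =>
      have : ∑ j, |y (b + 1) j - y a j| ≤
          ∑ j, |y (b + 1) j - y b j| + ∑ j, |y b j - y a j| := by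
        rw [← Finset.sum_add_distrib]
        exact Finset.sum_le_sum fun j _ => abs_sub_le _ _ _
      simp only [S, Finset.sum_range_succ] at ih ⊢
      linarith
  have htel : ∀ f : Fin (k + 1) → ℤ,
      ∑ i : Fin k, (f i.succ - f i.castSucc) = f (Fin.last k) - f 0 := by
    intro f
    have h := (Fin.sum_univ_succ f).symm.trans (Fin.sum_univ_castSucc f)
    rw [Finset.sum_sub_distrib]
    linarith
  calc _ ≤ ∑ i : Fin k, (S (e i.succ) - S (e i.castSucc)) :=
        Finset.sum_le_sum fun i _ => hstep _ _ (he (Fin.castSucc_le_succ i))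
    _ = S (e (Fin.last k)) - S (e 0) := htel fun i => S (e i)
    _ ≤ S (ℓ - 1) := by
        have h1 : S (e (Fin.last k)) ≤ S (ℓ - 1) := hS (by have := hlt (Fin.last k); omega)
        have h2 : S 0 ≤ S (e 0) := hS (Nat.zero_le _)
        simp only [S, Finset.sum_range_zero] at h1 h2 ⊢
        linarith

lemma sum_prod_kernel_le {β : Type*} [Fintype β] (w : β → β → ℝ) (hw : ∀ a b, 0 ≤ w a b)
    {K : ℝ} (hK : ∀ a, ∑ b, w a b ≤ K) (k : ℕ) :
    ∑ x : Fin (k + 1) → β, ∏ i : Fin k, w (x i.castSucc) (x i.succ) ≤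
      Fintype.card β * K ^ k := by
  induction k with
  | zero => simp
  | succ k ih =>
    rcases isEmpty_or_nonempty β with hβ | ⟨⟨a⟩⟩
    · simp
    have hK0 : 0 ≤ K := (Finset.sum_nonneg fun b _ => hw a b).trans (hK a)
    rw [← (Fin.snocEquiv fun _ : Fin (k + 2) => β).sum_comp, Fintype.sum_prod_type_right]
    have : ∀ x : Fin (k + 1) → β, ∀ b : β,
        ∏ i : Fin (k + 1), w (Fin.snoc (α := fun _ => β) x b i.castSucc)
          (Fin.snoc (α := fun _ => β) x b i.succ) =
        (∏ i : Fin k, w (x i.castSucc) (x i.succ)) * w (x (Fin.last k)) b := by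
      intro x b
      rw [Fin.prod_univ_castSucc]
      simp only [Fin.snoc_castSucc, Fin.succ_last, Fin.snoc_last, Fin.succ_castSucc]
    calc _ = ∑ x : Fin (k + 1) → β, ∑ b,
          (∏ i : Fin k, w (x i.castSucc) (x i.succ)) * w (x (Fin.last k)) b :=
          Finset.sum_congr rfl fun x _ => Finset.sum_congr rfl fun b _ => this x b
      _ ≤ ∑ x : Fin (k + 1) → β, (∏ i : Fin k, w (x i.castSucc) (x i.succ)) * K := by
          refine Finset.sum_le_sum fun x _ => ?_
          rw [← Finset.mul_sum]
          exact mul_le_mul_of_nonneg_left (hK _) (Finset.prod_nonneg fun i _ => hw _ _)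
      _ ≤ Fintype.card β * K ^ k * K := by
          rw [← Finset.sum_mul]
          exact mul_le_mul_of_nonneg_right ih hK0
      _ = _ := by ring

lemma sum_pow_natAbs_sub_le {r : ℝ} (h0 : 0 ≤ r) (h1 : r < 1) (S : Finset ℤ) (c : ℤ) :
    ∑ t ∈ S, r ^ (t - c).natAbs ≤ (1 + r) / (1 - r) := by
  have hg := hasSum_geometric_of_lt_one h0 h1
  have hsum : HasSum (fun t : ℤ => r ^ t.natAbs) ((1 - r)⁻¹ + r * (1 - r)⁻¹) := by
    refine HasSum.of_nat_of_neg_add_one (by simpa using hg) ?_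
    have : ∀ n : ℕ, (-((n : ℤ) + 1)).natAbs = n + 1 := fun n => by omega
    simpa only [this, pow_succ'] using hg.mul_left r
  have heq : (1 - r)⁻¹ + r * (1 - r)⁻¹ = (1 + r) / (1 - r) := by ring
  rw [heq] at hsum
  have hshift := (Equiv.subRight c).hasSum_iff.2 hsum
  exact sum_le_hasSum S (fun t _ => by simpa using pow_nonneg h0 _) hshift

lemma sum_box_pow_l1_le {d : ℕ} (L : ℕ) {r : ℝ} (h0 : 0 ≤ r) (h1 : r < 1) (a : Fin d → ℤ) :
    ∑ b ∈ Fintype.piFinset fun _ : Fin d => Finset.Icc (-(L : ℤ)) L,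
      r ^ (∑ j, (b j - a j).natAbs) ≤ ((1 + r) / (1 - r)) ^ d := by
  simp only [← Finset.prod_pow_eq_pow_sum]
  rw [Finset.sum_prod_piFinset (Finset.Icc (-(L : ℤ)) L) fun j t => r ^ (t - a j).natAbs]
  calc _ ≤ ∏ _j : Fin d, (1 + r) / (1 - r) :=
        Finset.prod_le_prod (fun j _ => Finset.sum_nonneg fun t _ => pow_nonneg h0 _)
          fun j _ => sum_pow_natAbs_sub_le h0 h1 _ _
    _ = _ := by rw [Finset.prod_const, Finset.card_univ, Fintype.card_fin]

/-- A heavy path contains a long `M`-separated chain of open sites. -/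
lemma exists_open_chain {d L ℓ M k : ℕ} {I : (Fin d → ℤ) → ℕ} (h1 : ∀ x, I x ≤ 1)
    {y : ℕ → Fin d → ℤ} (hy : pathIn d L ℓ y)
    (hk : (2 * M + 1) ^ d * k < ∑ i ∈ Finset.range ℓ, I (y i)) :
    ∃ x : Fin (k + 1) → Fin d → ℤ, (∀ i j, |x i j| ≤ (L : ℤ)) ∧
      (∀ i j, i ≠ j → (M : ℤ) < ∑ a, |x j a - x i a|) ∧
      (∑ i : Fin k, ∑ j, |x i.succ j - x i.castSucc j|) ≤ (L : ℤ) ∧ ∀ i, I (x i) = 1 := by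
  classical
  obtain ⟨-, hbox, hinj, hlen⟩ := hy
  let T := (Finset.range ℓ).filter fun i => I (y i) = 1
  have hT : ∑ i ∈ Finset.range ℓ, I (y i) = T.card := by
    rw [Finset.card_filter]
    refine Finset.sum_congr rfl fun i _ => ?_
    have := h1 (y i)
    split_ifs <;> omega
  have hTlt : ∀ i ∈ T, i < ℓ := fun i hi => Finset.mem_range.1 (Finset.mem_filter.1 hi).1
  obtain ⟨U, hUT, hsep, hcard⟩ := exists_separated_subset M y T fun i hi j hj h =>
    hinj i j (hTlt i hi) (hTlt j hj) h
  have hkU : k + 1 ≤ U.card := lt_of_mul_lt_mul_left (hk.trans_le (hT ▸ hcard)) (Nat.zero_le _)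
  obtain ⟨V, hVU, hV⟩ := Finset.exists_subset_card_eq hkU
  let e := V.orderEmbOfFin hV
  have heU : ∀ i, e i ∈ U := fun i => hVU (V.orderEmbOfFin_mem hV i)
  have hlt : ∀ i, e i < ℓ := fun i => hTlt _ (hUT (heU i))
  exact ⟨fun i => y (e i), fun i j => hbox _ (hlt i) j,
    fun i j hij => hsep _ (heU i) _ (heU j) (e.injective.ne hij),
    (sum_l1_subpath_le y e e.monotone hlt).trans hlen,
    fun i => (Finset.mem_filter.1 (hUT (heU i))).2⟩

lemma exists_pathIn_of_XL_pos {d : ℕ} {Ω : Type*} {I : (Fin d → ℤ) → Ω → ℕ} {L : ℕ} {ω : Ω}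
    (h : 0 < XL I L ω) :
    ∃ ℓ y, pathIn d L ℓ y ∧ XL I L ω = ∑ i ∈ Finset.range ℓ, I (y i) ω := by
  refine Nat.sSup_mem
    (s := {n : ℕ | ∃ ℓ y, pathIn d L ℓ y ∧ n = ∑ i ∈ Finset.range ℓ, I (y i) ω}) ?_ ?_
  · by_contra! hs
    simp [XL, hs] at h
  · by_contra hb
    simp [XL, Nat.sSup_of_not_bddAbove hb] at h

/-- First-moment bound over separated chains, with the length constraint relaxed by the
weight `r`. -/
lemma measureReal_lt_XL_le {d : ℕ} {Ω : Type*} [MeasurableSpace Ω]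
    {μ : Measure Ω} [IsProbabilityMeasure μ] {I : (Fin d → ℤ) → Ω → ℕ} {M : ℕ}
    (h1 : ∀ x ω, I x ω ≤ 1) (hI : MDependent μ I M)
    {q : ℝ} (hq : ∀ x, μ.real {ω | I x ω = 1} ≤ q) (L k : ℕ) {r : ℝ} (hr0 : 0 < r) (hr1 : r < 1) :
    μ.real {ω | (2 * M + 1) ^ d * k < XL I L ω} ≤
      (2 * L + 1) ^ d * (((1 + r) / (1 - r)) ^ d) ^ k * (r⁻¹ ^ L * q ^ (k + 1)) := by
  classical
  let B := Fintype.piFinset fun _ : Fin d => Finset.Icc (-(L : ℤ)) L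
  let w : B → B → ℝ := fun a b => r ^ (∑ j, (b.1 j - a.1 j).natAbs)
  have hw : ∀ a b, 0 ≤ w a b := fun a b => pow_nonneg hr0.le _
  have hK : ∀ a, ∑ b, w a b ≤ ((1 + r) / (1 - r)) ^ d := fun a => by
    rw [Finset.sum_coe_sort B fun b => r ^ (∑ j, (b j - a.1 j).natAbs)]
    exact sum_box_pow_l1_le L hr0.le hr1 a.1
  have hq0 : 0 ≤ q := measureReal_nonneg.trans (hq 0)
  let F : Finset (Fin (k + 1) → B) := Finset.univ.filter fun x =>
    (∀ i j, i ≠ j → (M : ℤ) < ∑ a, |(x j).1 a - (x i).1 a|) ∧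
      (∑ i : Fin k, ∑ j, |(x i.succ).1 j - (x i.castSucc).1 j|) ≤ (L : ℤ)
  have hcover : {ω | (2 * M + 1) ^ d * k < XL I L ω} ⊆
      ⋃ x ∈ F, {ω | ∀ i, I (x i).1 ω = 1} := by
    intro ω hω
    have hω' : (2 * M + 1) ^ d * k < XL I L ω := hω
    obtain ⟨ℓ, y, hy, hX⟩ := exists_pathIn_of_XL_pos ((Nat.zero_le _).trans_lt hω')
    rw [hX] at hω'
    obtain ⟨x, hbox, hsep, hlen, hopen⟩ := exists_open_chain (fun x => h1 x ω) hy hω'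
    have hB : ∀ i, x i ∈ B := fun i => by
      simp only [B, Fintype.mem_piFinset, Finset.mem_Icc]
      exact fun j => abs_le.1 (hbox i j)
    simp only [Set.mem_iUnion]
    exact ⟨fun i => ⟨x i, hB i⟩, Finset.mem_filter.2 ⟨Finset.mem_univ _, hsep, hlen⟩, hopen⟩
  have hterm : ∀ x ∈ F, μ.real {ω | ∀ i, I (x i).1 ω = 1} ≤
      (∏ i : Fin k, w (x i.castSucc) (x i.succ)) * (r⁻¹ ^ L * q ^ (k + 1)) := by
    intro x hx
    obtain ⟨-, hsep, hlen⟩ := Finset.mem_filter.1 hx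
    have hinj : Function.Injective fun i => (x i).1 := by
      intro i j hij
      by_contra hne
      have := hsep i j hne
      simp only at hij
      simp [hij] at this
      omega
    have hprob : μ.real {ω | ∀ i, I (x i).1 ω = 1} ≤ q ^ (k + 1) := by
      have := hI.measureReal_forall_eq_one_le hq (Finset.univ.image fun i => (x i).1) (by
        simp only [Finset.mem_image, Finset.mem_univ, true_and]
        rintro _ ⟨i, rfl⟩ _ ⟨j, rfl⟩ hij
        exact hsep i j (by rintro rfl; exact hij rfl))
      simpa [Finset.card_image_of_injective _ hinj] using this
    have hlen' : ∑ i : Fin k, ∑ j, ((x i.succ).1 j - (x i.castSucc).1 j).natAbs ≤ L := by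
      zify
      exact hlen
    have hweight : 1 ≤ (∏ i : Fin k, w (x i.castSucc) (x i.succ)) * r⁻¹ ^ L := by
      rw [Finset.prod_pow_eq_pow_sum, inv_pow, ← div_eq_mul_inv, one_le_div (pow_pos hr0 _)]
      exact pow_le_pow_of_le_one hr0.le hr1.le hlen'
    rw [← mul_assoc]
    exact hprob.trans (le_mul_of_one_le_left (pow_nonneg hq0 _) hweight)
  have hcardB : (Fintype.card B : ℝ) = (2 * L + 1) ^ d := by
    have : (Finset.Icc (-(L : ℤ)) L).card = 2 * L + 1 := by rw [Int.card_Icc]; omega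
    simp [B, this]
  have hR : 0 ≤ r⁻¹ ^ L * q ^ (k + 1) := by positivity
  have hsum : ∑ x ∈ F, (∏ i : Fin k, w (x i.castSucc) (x i.succ)) ≤
      (2 * L + 1) ^ d * (((1 + r) / (1 - r)) ^ d) ^ k := by
    rw [← hcardB]
    refine le_trans ?_ (sum_prod_kernel_le w hw hK k)
    exact Finset.sum_le_univ_sum_of_nonneg fun x => Finset.prod_nonneg fun i _ => hw _ _
  refine (measureReal_mono hcover (measure_ne_top μ _)).trans ?_
  refine (measureReal_biUnion_finset_le _ _).trans ?_
  refine (Finset.sum_le_sum hterm).trans ?_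
  rw [← Finset.sum_mul]
  exact mul_le_mul_of_nonneg_right hsum hR

/-- The first-moment bound at `r = 1 / (1 + 8p)` with `p = q ^ (1 / d)`. -/
lemma chain_bound_le_exp {d L k : ℕ} (hd : 2 ≤ d) (hL : 1 ≤ L) {p u : ℝ} (hp0 : 0 < p)
    (hp : p ≤ 1 / 4) (hk : (3 * d + 8) * (L * p) ≤ k + 1) (hu : u ≤ (3 / 16) * (k + 1)) :
    (2 * L + 1) ^ d * (((1 + (1 + 8 * p)⁻¹) / (1 - (1 + 8 * p)⁻¹)) ^ d) ^ k *
        (((1 + 8 * p)⁻¹)⁻¹ ^ L * (p ^ d) ^ (k + 1)) ≤ 2 ^ d * Real.exp (-u) := by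
  have hL' : (1 : ℝ) ≤ L := by exact_mod_cast hL
  have hd' : (2 : ℝ) ≤ d := by exact_mod_cast hd
  have hfrac : (1 + (1 + 8 * p)⁻¹) / (1 - (1 + 8 * p)⁻¹) * p = p + 1 / 4 := by
    have : (1 : ℝ) + 8 * p ≠ 0 := by positivity
    have h2 : 1 - (1 + 8 * p)⁻¹ = 8 * p / (1 + 8 * p) := by field_simp; ring
    rw [h2]
    field_simp
    ring
  have h3 : ((2 * L + 1) * p) ^ d ≤ Real.exp (3 * d * (L * p)) := by
    have h : (2 * L + 1) * p ≤ Real.exp (3 * (L * p)) := by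
      have := Real.add_one_le_exp (3 * (L * p))
      nlinarith
    calc _ ≤ Real.exp (3 * (L * p)) ^ d := pow_le_pow_left₀ (by positivity) h d
      _ = _ := by rw [← Real.exp_nat_mul]; congr 1; ring
  have h8 : (1 + 8 * p) ^ L ≤ Real.exp (8 * (L * p)) := by
    have h : 1 + 8 * p ≤ Real.exp (8 * p) := by linarith [Real.add_one_le_exp (8 * p)]
    calc _ ≤ Real.exp (8 * p) ^ L := pow_le_pow_left₀ (by positivity) h L
      _ = _ := by rw [← Real.exp_nat_mul]; congr 1; ring
  have hhalf : ((p + 1 / 4) ^ d) ^ k ≤ 2 ^ d * Real.exp (-(d * (k + 1) * Real.log 2)) := by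
    have hexp : Real.exp (-(d * (k + 1) * Real.log 2)) = ((1 / 2 : ℝ) ^ d) ^ (k + 1) := by
      rw [← pow_mul, one_div, inv_pow, Real.exp_neg, ← Real.exp_log (show (0 : ℝ) < 2 by norm_num),
        ← Real.exp_nat_mul, Real.log_exp]
      push_cast
      ring_nf
    have h2 : (2 : ℝ) ^ d * (1 / 2) ^ d = 1 := by rw [← mul_pow]; norm_num
    rw [hexp, pow_succ', ← mul_assoc, h2, one_mul]
    gcongr
    linarith
  calc _ = ((2 * L + 1) * p) ^ d *
        (((1 + (1 + 8 * p)⁻¹) / (1 - (1 + 8 * p)⁻¹) * p) ^ d) ^ k * (1 + 8 * p) ^ L := by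
        rw [inv_inv, mul_pow _ p d, mul_pow _ p d, mul_pow _ (p ^ d) k, pow_succ]
        ring
    _ ≤ Real.exp (3 * d * (L * p)) * (2 ^ d * Real.exp (-(d * (k + 1) * Real.log 2))) *
          Real.exp (8 * (L * p)) := by
        rw [hfrac]
        gcongr
    _ = 2 ^ d * Real.exp (3 * d * (L * p) + -(d * (k + 1) * Real.log 2) + 8 * (L * p)) := by
        rw [Real.exp_add, Real.exp_add]
        ring
    _ ≤ _ := by
        gcongr
        have hlog := Real.log_two_gt_d9
        have hk0 : (0 : ℝ) ≤ k := Nat.cast_nonneg k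
        have : 2 * ((k : ℝ) + 1) * 0.69 ≤ d * (k + 1) * Real.log 2 := by
          gcongr
          linarith
        linarith

/-- Tail bound for the maximal weight of paths in `M`-dependent site-percolation:
there is `C = C(d) > 0` such that if `{I_x}` is `M`-dependent with
`q_M = sup_x E(I_x) ≤ (3M+1)^{-d}`, then for all `L ≥ 1` and all real
`n ≥ C M^d max{1, M L q_M^{1/d}}`, `P(X_L ≥ n) ≤ 2^d exp(-n / (16M)^d)`. -/
theorem mdep_perc_weight_tail (d : ℕ) (hd : 2 ≤ d) :
    ∃ C : ℝ, 0 < C ∧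
      ∀ (M : ℕ), 1 ≤ M →
      ∀ (Ω : Type) [MeasurableSpace Ω] (μ : Measure Ω), IsProbabilityMeasure μ →
      ∀ (I : (Fin d → ℤ) → Ω → ℕ),
      (∀ x, Measurable (I x)) → (∀ x ω, I x ω ≤ 1) →
      MDependent μ I M →
      qsup μ I ≤ 1 / ((3 * M + 1 : ℝ) ^ d) →
      ∀ (L : ℕ) (n : ℝ), 1 ≤ L →
        C * (M : ℝ) ^ d * max 1 ((M : ℝ) * L * qsup μ I ^ ((1 : ℝ) / d)) ≤ n →
        (μ {ω | n ≤ (XL I L ω : ℝ)}).toReal ≤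
          2 ^ d * Real.exp (-n / (16 * (M : ℝ)) ^ d) := by
  refine ⟨3 ^ d * (3 * d + 8), by positivity, ?_⟩
  intro M hM Ω _ μ _ I hm h1 hI hq L n hL hn
  have hM' : (1 : ℝ) ≤ M := by exact_mod_cast hM
  have hqx := measureReal_eq_one_le_qsup (μ := μ) hm h1
  have hq0 : 0 ≤ qsup μ I := measureReal_nonneg.trans (hqx 0)
  set q := qsup μ I
  set p := q ^ ((1 : ℝ) / d) with hpdef
  have hp0 : 0 ≤ p := Real.rpow_nonneg hq0 _
  have hpd : p ^ d = q := by
    rw [hpdef, one_div, Real.rpow_inv_natCast_pow hq0 (by omega)]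
  set v := n / (3 * M) ^ d with hv
  have hvn : v * (3 * M) ^ d = n := by rw [hv]; field_simp
  have hvmax : (3 * d + 8) * max 1 (M * L * p) ≤ v := by
    rw [hv, le_div_iff₀ (by positivity), mul_pow]
    linarith
  have hv1 : 3 * d + 8 ≤ v :=
    (le_mul_of_one_le_right (by positivity) (le_max_left _ _)).trans hvmax
  have hvpos : 0 < v := lt_of_lt_of_le (by positivity) hv1
  obtain ⟨k, hk⟩ : ∃ k, ⌈v⌉₊ = k + 1 :=
    Nat.exists_eq_succ_of_ne_zero (Nat.ceil_pos.2 hvpos).ne'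
  have hvk : v ≤ k + 1 := by exact_mod_cast hk ▸ Nat.le_ceil v
  have hkv : (k : ℝ) < v := Nat.lt_ceil.1 (by omega)
  have hsub : {ω | n ≤ (XL I L ω : ℝ)} ⊆ {ω | (2 * M + 1) ^ d * k < XL I L ω} := by
    intro ω hω
    have h : ((2 * M + 1) ^ d * k : ℝ) < XL I L ω := by
      calc ((2 * M + 1) ^ d * k : ℝ) ≤ (3 * M) ^ d * k := by gcongr; linarith
        _ < (3 * M) ^ d * v := by gcongr
        _ = n := by rw [mul_comm, hvn]
        _ ≤ _ := hω
    exact_mod_cast h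
  have hbound := fun (r : ℝ) (hr0 : 0 < r) (hr1 : r < 1) =>
    (measureReal_mono hsub (measure_ne_top μ _)).trans
      (measureReal_lt_XL_le h1 hI hqx L k hr0 hr1)
  rw [← measureReal_def]
  rcases hp0.eq_or_lt with hp | hp
  · have hqz : q = 0 := by rw [← hpd, ← hp, zero_pow (by omega)]
    have := hbound (1 / 2) (by norm_num) (by norm_num)
    change _ ≤ _ * (_ * q ^ (k + 1)) at this
    rw [hqz, zero_pow (by omega), mul_zero, mul_zero] at this
    exact this.trans (by positivity)
  · refine (hbound (1 + 8 * p)⁻¹ (by positivity) (inv_lt_one_of_one_lt₀ (by linarith))).trans ?_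
    change _ * (_ * q ^ (k + 1)) ≤ _
    rw [← hpd, neg_div]
    refine chain_bound_le_exp hd hL hp ?_ ?_ ?_
    · refine le_of_pow_le_pow_left₀ (n := d) (by omega) (by norm_num) ?_
      rw [hpd, div_pow, one_pow]
      refine hq.trans ?_
      gcongr
      linarith
    · refine le_trans ?_ (hvmax.trans hvk)
      have : L * p ≤ M * L * p := by
        rw [mul_assoc]
        exact le_mul_of_one_le_left (by positivity) hM'
      gcongr
      exact this.trans (le_max_right _ _)
    · have : n / (16 * M) ^ d = (3 / 16) ^ d * v := by
        rw [hv, mul_pow, mul_pow, div_pow]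
        field_simp
      rw [this]
      have h316 : (3 / 16 : ℝ) ^ d ≤ 3 / 16 :=
        pow_le_of_le_one (by norm_num) (by norm_num) (by omega)
      gcongr
end
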